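/- Let w be a weight sequence with w(0) = 1 and w(k) > 0 for some k ≥ 2, and let π be the associated probability measure on ℤ₊ (defined via ρ, Φ, Ψ, ν and ξ as in the context). Let C ⊆ ℕ be nonempty, and for P a partition let ζ_C(P) be the number of blocks of P whose size lies in C; set π(C) = Σ_{k∈C} π(k). Then, as n → ∞ along admissible n: (a) for every ε > 0, Σ_{P ∈ ℕℂ_n : |ζ_C(P)/n − π(C)| > ε} Ω^w(P)/Z^w_n → 0 (i.e. ζ_C(P_n)/n → π(C) in ℙ^w_n-probability); and (b) Σ_{P ∈ ℕℂ_n} Ω^w(P)·ζ_C(P)/(n·Z^w_n) → π(C) (i.e. 𝔼^w_n[ζ_C]/n → π(C)). -/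

import Mathlib

open scoped Classical

/-- `P` is a set partition of `[n] = {1, …, n}`: its blocks are nonempty subsets of
`{1, …, n}` and every element of `{1, …, n}` lies in exactly one block. -/
def IsPartitionOf (n : ℕ) (P : Finset (Finset ℕ)) : Prop :=
  (∀ B ∈ P, B ⊆ Finset.Icc 1 n ∧ B.Nonempty) ∧
    ∀ x ∈ Finset.Icc 1 n, ∃! B, B ∈ P ∧ x ∈ B

/-- A partition is non-crossing when there are no `a < b < c < d` with `a, c` in one
block and `b, d` in another, distinct block. -/
def IsNonCrossing (P : Finset (Finset ℕ)) : Prop :=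
  ∀ B ∈ P, ∀ B' ∈ P, B ≠ B' →
    ∀ a b c d : ℕ, a < b → b < c → c < d →
      a ∈ B → c ∈ B → b ∈ B' → d ∈ B' → False

/-- The (finite) set of non-crossing partitions of `[n]`. -/
noncomputable def NCP (n : ℕ) : Finset (Finset (Finset ℕ)) :=
  (Finset.Icc 1 n).powerset.powerset.filter fun P => IsPartitionOf n P ∧ IsNonCrossing P

/-- The set of non-crossing partitions of `[n]` all of whose block sizes belong to `A`. -/
noncomputable def NCPA (A : Set ℕ) (n : ℕ) : Finset (Finset (Finset ℕ)) :=
  (NCP n).filter fun P => ∀ B ∈ P, B.card ∈ A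

/-- The probability measure `π_A` on `ℤ₊` associated with `A` and `ξ = ξ_A`. -/
noncomputable def piA (A : Set ℕ) (ξ : ℝ) (k : ℕ) : ℝ :=
  if k = 0 ∨ k ∈ A then ξ ^ k / (1 + ∑' i : A, ξ ^ (i : ℕ)) else 0

/-- The weight of a partition: product of `w(size of B)` over blocks `B`. -/
noncomputable def OmegaP (w : ℕ → ℝ) (P : Finset (Finset ℕ)) : ℝ :=
  ∏ B ∈ P, w B.card

/-- The partition function `Z^w_n` of simply generated non-crossing partitions. -/
noncomputable def Zw (w : ℕ → ℝ) (n : ℕ) : ℝ :=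
  ∑ P ∈ NCP n, OmegaP w P

/-- `(limsup_k w(k)^{1/k})` as an extended nonnegative real; `ρ` is its inverse. -/
noncomputable def wLimsup (w : ℕ → ℝ) : ENNReal :=
  Filter.limsup (fun k : ℕ => ENNReal.ofReal (w k ^ (1 / (k : ℝ)))) Filter.atTop

/-- `π` is the probability measure on `ℤ₊` associated with the weight sequence `w`,
defined via `ρ = (limsup w(k)^{1/k})⁻¹`, `Φ`, `Ψ`, `ν` and `ξ`:
if `ρ = 0` then `π = δ_0`; otherwise `π(k) = w(k) ξ^k / Φ(ξ)` where either
`Ψ(ξ) = 1` (case `ν ≥ 1`) or `ξ = ρ` and `Ψ(ρ) ≤ 1` (case `ν < 1`). -/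
def PiSpec (w : ℕ → ℝ) (π : ℕ → ℝ) : Prop :=
  (wLimsup w = ⊤ ∧ π 0 = 1 ∧ ∀ k : ℕ, 1 ≤ k → π k = 0) ∨
  (wLimsup w ≠ ⊤ ∧ ∃ ξ : ℝ, 0 < ξ ∧ ENNReal.ofReal ξ ≤ (wLimsup w)⁻¹ ∧
    (Summable fun k : ℕ => (k : ℝ) * w k * ξ ^ k) ∧
    (∀ k : ℕ, π k = w k * ξ ^ k / ∑' j : ℕ, w j * ξ ^ j) ∧
    (∑' k : ℕ, (k : ℝ) * w k * ξ ^ k = ∑' k : ℕ, w k * ξ ^ k ∨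
      (ENNReal.ofReal ξ = (wLimsup w)⁻¹ ∧
        ∑' k : ℕ, (k : ℝ) * w k * ξ ^ k ≤ ∑' k : ℕ, w k * ξ ^ k)))

/-- `P` is a non-crossing partition of the finite set `S`. -/
structure IsNC (S : Finset ℕ) (P : Finset (Finset ℕ)) : Prop where
  nonempty : ∀ B ∈ P, B.Nonempty
  mem_iff : ∀ x, x ∈ S ↔ ∃ B ∈ P, x ∈ B
  eq_of_mem : ∀ B ∈ P, ∀ B' ∈ P, ∀ x, x ∈ B → x ∈ B' → B = B'
  nonCrossing : IsNonCrossing P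

/-- The finite set of non-crossing partitions of `S`. -/
noncomputable def ncOn (S : Finset ℕ) : Finset (Finset (Finset ℕ)) :=
  S.powerset.powerset.filter (IsNC S)

namespace IsNC

variable {S : Finset ℕ} {P P' : Finset (Finset ℕ)}

theorem subset (h : IsNC S P) {B : Finset ℕ} (hB : B ∈ P) : B ⊆ S :=
  fun x hx => (h.mem_iff x).2 ⟨B, hB, hx⟩

theorem eq_of_subset (h : IsNC S P) (h' : IsNC S P') (hs : P ⊆ P') : P = P' := by
  refine hs.antisymm fun B hB => ?_
  obtain ⟨x, hx⟩ := h'.nonempty B hB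
  obtain ⟨B', hB', hx'⟩ := (h.mem_iff x).1 (h'.subset hB hx)
  rwa [h'.eq_of_mem B hB B' (hs hB') x hx hx']

theorem sum_card (h : IsNC S P) : ∑ B ∈ P, B.card = S.card := by
  have hS : S = P.biUnion id := by
    ext x
    simp [h.mem_iff]
  rw [hS, Finset.card_biUnion]
  · rfl
  · intro B hB B' hB' hne
    exact Finset.disjoint_left.2 fun x hx hx' => hne (h.eq_of_mem B hB B' hB' x hx hx')

end IsNC

theorem mem_ncOn {S : Finset ℕ} {P : Finset (Finset ℕ)} : P ∈ ncOn S ↔ IsNC S P := by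
  simp only [ncOn, Finset.mem_filter, Finset.mem_powerset, and_iff_right_iff_imp]
  exact fun h B hB => Finset.mem_powerset.2 (h.subset hB)

theorem mem_NCP {n : ℕ} {P : Finset (Finset ℕ)} : P ∈ NCP n ↔ IsNC (Finset.Icc 1 n) P := by
  simp only [NCP, Finset.mem_filter, Finset.mem_powerset]
  constructor
  · rintro ⟨-, ⟨h1, h2⟩, h3⟩
    refine ⟨fun B hB => (h1 B hB).2, fun x => ⟨fun hx => ?_, ?_⟩, ?_, h3⟩
    · obtain ⟨B, hB, -⟩ := h2 x hx
      exact ⟨B, hB⟩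
    · rintro ⟨B, hB, hx⟩
      exact (h1 B hB).1 hx
    · intro B hB B' hB' x hx hx'
      exact (h2 x ((h1 B hB).1 hx)).unique ⟨hB, hx⟩ ⟨hB', hx'⟩
  · intro h
    refine ⟨fun B hB => Finset.mem_powerset.2 (h.subset hB),
      ⟨fun B hB => ⟨h.subset hB, h.nonempty B hB⟩, fun x hx => ?_⟩, h.nonCrossing⟩
    obtain ⟨B, hB, hxB⟩ := (h.mem_iff x).1 hx
    exact ⟨B, ⟨hB, hxB⟩, fun B' hB' => h.eq_of_mem B' hB'.1 B hB x hB'.2 hxB⟩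

theorem NCP_eq_ncOn (n : ℕ) : NCP n = ncOn (Finset.Icc 1 n) := by
  ext P
  rw [mem_NCP, mem_ncOn]

/-- The trace of a partition on a subset. -/
noncomputable def restrictTo (P : Finset (Finset ℕ)) (S : Finset ℕ) : Finset (Finset ℕ) :=
  (P.image (· ∩ S)).erase ∅

theorem mem_restrictTo {P : Finset (Finset ℕ)} {S D : Finset ℕ} :
    D ∈ restrictTo P S ↔ D.Nonempty ∧ ∃ B ∈ P, B ∩ S = D := by
  simp [restrictTo, Finset.nonempty_iff_ne_empty]

theorem IsNC.isNC_restrictTo {S S' : Finset ℕ} {P : Finset (Finset ℕ)} (h : IsNC S P) (hS : S' ⊆ S) :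
    IsNC S' (restrictTo P S') := by
  refine ⟨fun B hB => (mem_restrictTo.1 hB).1, fun x => ⟨fun hx => ?_, ?_⟩, ?_, ?_⟩
  · obtain ⟨B, hB, hxB⟩ := (h.mem_iff x).1 (hS hx)
    have hx' : x ∈ B ∩ S' := Finset.mem_inter.2 ⟨hxB, hx⟩
    exact ⟨B ∩ S', mem_restrictTo.2 ⟨⟨x, hx'⟩, B, hB, rfl⟩, hx'⟩
  · rintro ⟨D, hD, hx⟩
    obtain ⟨-, B, hB, rfl⟩ := mem_restrictTo.1 hD
    exact (Finset.mem_inter.1 hx).2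
  · intro D hD D' hD' x hx hx'
    obtain ⟨-, B, hB, rfl⟩ := mem_restrictTo.1 hD
    obtain ⟨-, B', hB', rfl⟩ := mem_restrictTo.1 hD'
    rw [h.eq_of_mem B hB B' hB' x (Finset.mem_inter.1 hx).1 (Finset.mem_inter.1 hx').1]
  · intro D hD D' hD' hne a b c d hab hbc hcd ha hc hb hd
    obtain ⟨-, B, hB, rfl⟩ := mem_restrictTo.1 hD
    obtain ⟨-, B', hB', rfl⟩ := mem_restrictTo.1 hD'
    simp only [Finset.mem_inter] at ha hb hc hd
    exact h.nonCrossing B hB B' hB' (fun e => hne (by rw [e])) a b c d hab hbc hcd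
      ha.1 hc.1 hb.1 hd.1

/-- The block of `P` containing `m` (empty if there is none). -/
noncomputable def blockOf (P : Finset (Finset ℕ)) (m : ℕ) : Finset ℕ :=
  (P.filter (m ∈ ·)).biUnion id

theorem IsNC.filter_mem_eq {S : Finset ℕ} {P : Finset (Finset ℕ)} (h : IsNC S P) {B : Finset ℕ}
    (hB : B ∈ P) {m : ℕ} (hm : m ∈ B) : P.filter (m ∈ ·) = {B} := by
  ext D
  simp only [Finset.mem_filter, Finset.mem_singleton]
  exact ⟨fun hD => h.eq_of_mem D hD.1 B hB m hD.2 hm, fun e => e ▸ ⟨hB, hm⟩⟩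

theorem IsNC.blockOf_eq {S : Finset ℕ} {P : Finset (Finset ℕ)} (h : IsNC S P) {B : Finset ℕ}
    (hB : B ∈ P) {m : ℕ} (hm : m ∈ B) : blockOf P m = B := by
  rw [blockOf, h.filter_mem_eq hB hm, Finset.singleton_biUnion, id]

theorem IsNC.blockOf_mem {S : Finset ℕ} {P : Finset (Finset ℕ)} (h : IsNC S P) {m : ℕ}
    (hm : m ∈ S) : blockOf P m ∈ P ∧ m ∈ blockOf P m := by
  obtain ⟨B, hB, hmB⟩ := (h.mem_iff m).1 hm
  rw [h.blockOf_eq hB hmB]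
  exact ⟨hB, hmB⟩

theorem IsNC.blockOf_cases {b : ℕ} {Q : Finset (Finset ℕ)} (h : IsNC (Finset.Icc 1 b) Q) :
    (blockOf Q b ∈ Q ∧ b ∈ blockOf Q b) ∨ (blockOf Q b = ∅ ∧ b = 0) := by
  rcases Nat.eq_zero_or_pos b with rfl | hb
  · refine Or.inr ⟨?_, rfl⟩
    have : Q.filter (0 ∈ ·) = ∅ := Finset.filter_eq_empty_iff.2 fun B hB h0 => by
      simpa using h.subset hB h0
    rw [blockOf, this, Finset.biUnion_empty]
  · exact Or.inl (h.blockOf_mem (by simp; omega))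

/-- Add the point `m` to the block of `Q` containing `b`, and add the blocks of `R`. -/
noncomputable def joinAt (b m : ℕ) (Q R : Finset (Finset ℕ)) : Finset (Finset ℕ) :=
  insert (insert m (blockOf Q b)) (Q.filter (b ∉ ·) ∪ R)

theorem mem_joinAt {b m : ℕ} {Q R : Finset (Finset ℕ)} {B : Finset ℕ} :
    B ∈ joinAt b m Q R ↔ B = insert m (blockOf Q b) ∨ (B ∈ Q ∧ b ∉ B) ∨ B ∈ R := by
  simp [joinAt]

theorem IsNC.isNC_joinAt {b n : ℕ} (hbn : b ≤ n) {Q R : Finset (Finset ℕ)}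
    (hQ : IsNC (Finset.Icc 1 b) Q) (hR : IsNC (Finset.Ioc b n) R) :
    IsNC (Finset.Icc 1 (n + 1)) (joinAt b (n + 1) Q R) := by
  have bQ : ∀ B ∈ Q, ∀ x ∈ B, 1 ≤ x ∧ x ≤ b := fun B hB x hx =>
    Finset.mem_Icc.1 (hQ.subset hB hx)
  have bR : ∀ B ∈ R, ∀ x ∈ B, b < x ∧ x ≤ n := fun B hB x hx =>
    Finset.mem_Ioc.1 (hR.subset hB hx)
  have bL : ∀ x ∈ blockOf Q b, 1 ≤ x ∧ x ≤ b := by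
    rcases hQ.blockOf_cases with h | h
    · exact bQ _ h.1
    · simp [h.1]
  have dL : ∀ B ∈ Q, b ∉ B → ∀ x ∈ B, x ∉ blockOf Q b := by
    intro B hB hb x hx hx'
    rcases hQ.blockOf_cases with h | h
    · exact hb (hQ.eq_of_mem B hB _ h.1 x hx hx' ▸ h.2)
    · simp [h.1] at hx'
  refine ⟨?_, ?_, ?_, ?_⟩
  · intro B hB
    rcases mem_joinAt.1 hB with rfl | h | h
    · exact Finset.insert_nonempty _ _
    · exact hQ.nonempty B h.1
    · exact hR.nonempty B h
  · intro x
    constructor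
    · intro hx
      rw [Finset.mem_Icc] at hx
      by_cases h1 : x ≤ b
      · obtain ⟨B, hB, hxB⟩ := (hQ.mem_iff x).1 (Finset.mem_Icc.2 ⟨hx.1, h1⟩)
        by_cases hb : b ∈ B
        · refine ⟨_, mem_joinAt.2 (Or.inl rfl), ?_⟩
          rw [hQ.blockOf_eq hB hb]
          exact Finset.mem_insert_of_mem hxB
        · exact ⟨B, mem_joinAt.2 (Or.inr (Or.inl ⟨hB, hb⟩)), hxB⟩
      · by_cases h2 : x ≤ n
        · obtain ⟨B, hB, hxB⟩ := (hR.mem_iff x).1 (Finset.mem_Ioc.2 ⟨by omega, h2⟩)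
          exact ⟨B, mem_joinAt.2 (Or.inr (Or.inr hB)), hxB⟩
        · exact ⟨_, mem_joinAt.2 (Or.inl rfl), Finset.mem_insert.2 (Or.inl (by omega))⟩
    · rintro ⟨B, hB, hx⟩
      rw [Finset.mem_Icc]
      rcases mem_joinAt.1 hB with rfl | h | h
      · rcases Finset.mem_insert.1 hx with rfl | hx
        · omega
        · have := bL x hx
          omega
      · have := bQ B h.1 x hx
        omega
      · have := bR B h x hx
        omega
  · intro B hB B' hB' x hx hx'
    rcases mem_joinAt.1 hB with rfl | h | h <;> rcases mem_joinAt.1 hB' with rfl | h' | h' <;>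
      grind [hQ.eq_of_mem, hR.eq_of_mem]
  · intro B hB B' hB' hne a₁ b₁ c₁ d₁ hab hbc hcd ha hc hb hd
    have ncQ := hQ.nonCrossing
    have ncR := hR.nonCrossing
    rcases mem_joinAt.1 hB with rfl | h | h <;> rcases mem_joinAt.1 hB' with rfl | h' | h'
    · exact hne rfl
    · rcases hQ.blockOf_cases with hL | hL
      · refine ncQ _ hL.1 B' h'.1 (fun e => h'.2 (e ▸ hL.2)) a₁ b₁ c₁ d₁ hab hbc hcd ?_ ?_ hb hd <;>
          grind
      · grind
    · grind
    · rcases hQ.blockOf_cases with hL | hL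
      · have hcb : c₁ < b := lt_of_le_of_ne (bQ B h.1 c₁ hc).2 (fun e => h.2 (e ▸ hc))
        refine ncQ B h.1 _ hL.1 (fun e => h.2 (e ▸ hL.2)) a₁ b₁ c₁ b hab hbc hcb ha hc ?_ hL.2
        grind
      · grind
    · exact ncQ B h.1 B' h'.1 hne a₁ b₁ c₁ d₁ hab hbc hcd ha hc hb hd
    · grind
    · grind
    · grind
    · exact ncR B h B' h' hne a₁ b₁ c₁ d₁ hab hbc hcd ha hc hb hd

/-- The predecessor of `m` in its block (`0` if there is none). -/
noncomputable def prevOf (P : Finset (Finset ℕ)) (m : ℕ) : ℕ :=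
  ((blockOf P m).erase m).sup id

theorem IsNC.joinAt_blockOf {b n : ℕ} (hbn : b ≤ n) {Q R : Finset (Finset ℕ)}
    (hQ : IsNC (Finset.Icc 1 b) Q) (hR : IsNC (Finset.Ioc b n) R) :
    blockOf (joinAt b (n + 1) Q R) (n + 1) = insert (n + 1) (blockOf Q b) :=
  (hQ.isNC_joinAt hbn hR).blockOf_eq (mem_joinAt.2 (Or.inl rfl)) (Finset.mem_insert_self _ _)

theorem IsNC.blockOf_le {b : ℕ} {Q : Finset (Finset ℕ)} (hQ : IsNC (Finset.Icc 1 b) Q) :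
    ∀ x ∈ blockOf Q b, x ≤ b := by
  rcases hQ.blockOf_cases with h | h
  · exact fun x hx => (Finset.mem_Icc.1 (hQ.subset h.1 hx)).2
  · simp [h.1]

theorem IsNC.prevOf_joinAt {b n : ℕ} (hbn : b ≤ n) {Q R : Finset (Finset ℕ)}
    (hQ : IsNC (Finset.Icc 1 b) Q) (hR : IsNC (Finset.Ioc b n) R) :
    prevOf (joinAt b (n + 1) Q R) (n + 1) = b := by
  have hL := hQ.blockOf_le
  rw [prevOf, hQ.joinAt_blockOf hbn hR, Finset.erase_insert fun h => by have := hL _ h; omega]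
  refine le_antisymm (Finset.sup_le hL) ?_
  rcases hQ.blockOf_cases with h | h
  · exact Finset.le_sup (f := id) h.2
  · simp [h.2]

theorem IsNC.prevOf_lt {n : ℕ} {P : Finset (Finset ℕ)} (h : IsNC (Finset.Icc 1 (n + 1)) P) :
    prevOf P (n + 1) < n + 1 := by
  refine (Finset.sup_lt_iff (Nat.succ_pos n)).2 fun x hx => ?_
  rw [Finset.mem_erase] at hx
  have := h.blockOf_le x hx.2
  simp only [id]
  omega

theorem IsNC.restrictTo_joinAt_left {b n : ℕ} (hbn : b ≤ n) {Q R : Finset (Finset ℕ)}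
    (hQ : IsNC (Finset.Icc 1 b) Q) (hR : IsNC (Finset.Ioc b n) R) :
    restrictTo (joinAt b (n + 1) Q R) (Finset.Icc 1 b) = Q := by
  have hS : Finset.Icc 1 b ⊆ Finset.Icc 1 (n + 1) := Finset.Icc_subset_Icc_right (by omega)
  refine (hQ.eq_of_subset ((hQ.isNC_joinAt hbn hR).isNC_restrictTo hS) fun B hB => ?_).symm
  refine mem_restrictTo.2 ⟨hQ.nonempty B hB, ?_⟩
  have hB' := Finset.inter_eq_left.2 (hQ.subset hB)
  by_cases hb : b ∈ B
  · refine ⟨_, mem_joinAt.2 (Or.inl rfl), ?_⟩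
    rw [hQ.blockOf_eq hB hb, Finset.insert_inter_of_notMem (by simp; omega), hB']
  · exact ⟨B, mem_joinAt.2 (Or.inr (Or.inl ⟨hB, hb⟩)), hB'⟩

theorem IsNC.restrictTo_joinAt_right {b n : ℕ} (hbn : b ≤ n) {Q R : Finset (Finset ℕ)}
    (hQ : IsNC (Finset.Icc 1 b) Q) (hR : IsNC (Finset.Ioc b n) R) :
    restrictTo (joinAt b (n + 1) Q R) (Finset.Ioc b n) = R := by
  have hS : Finset.Ioc b n ⊆ Finset.Icc 1 (n + 1) := fun x hx => by simp at hx ⊢; omega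
  refine (hR.eq_of_subset ((hQ.isNC_joinAt hbn hR).isNC_restrictTo hS) fun B hB => ?_).symm
  exact mem_restrictTo.2 ⟨hR.nonempty B hB, B, mem_joinAt.2 (Or.inr (Or.inr hB)),
    Finset.inter_eq_left.2 (hR.subset hB)⟩

theorem IsNC.joinAt_restrictTo {n : ℕ} {P : Finset (Finset ℕ)}
    (h : IsNC (Finset.Icc 1 (n + 1)) P) :
    joinAt (prevOf P (n + 1)) (n + 1)
      (restrictTo P (Finset.Icc 1 (prevOf P (n + 1))))
      (restrictTo P (Finset.Ioc (prevOf P (n + 1)) n)) = P := by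
  have hlt := h.prevOf_lt
  obtain ⟨hL, hm⟩ := h.blockOf_mem (m := n + 1) (by simp)
  have hLb : ∀ x ∈ blockOf P (n + 1), x ≠ n + 1 → x ≤ prevOf P (n + 1) := fun x hx hne =>
    Finset.le_sup (f := id) (Finset.mem_erase.2 ⟨hne, hx⟩)
  have hbL : 1 ≤ prevOf P (n + 1) → prevOf P (n + 1) ∈ blockOf P (n + 1) := by
    intro hb
    have hne : ((blockOf P (n + 1)).erase (n + 1)).Nonempty := by
      rw [Finset.nonempty_iff_ne_empty]
      intro he
      simp [prevOf, he] at hb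
    obtain ⟨x, hx, hx'⟩ := Finset.exists_mem_eq_sup _ hne id
    rw [prevOf, hx']
    exact (Finset.mem_erase.1 hx).2
  set b := prevOf P (n + 1) with hb
  set L := blockOf P (n + 1) with hLdef
  have hQ := h.isNC_restrictTo (S' := Finset.Icc 1 b) (Finset.Icc_subset_Icc_right (by omega))
  have hR := h.isNC_restrictTo (S' := Finset.Ioc b n) (fun x hx => by simp at hx ⊢; omega)
  refine (h.eq_of_subset (hQ.isNC_joinAt (by omega) hR) fun B hB => ?_).symm
  have hBS : ∀ x ∈ B, 1 ≤ x ∧ x ≤ n + 1 := fun x hx => Finset.mem_Icc.1 (h.subset hB hx)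
  rw [mem_joinAt]
  by_cases hBL : B = L
  · rw [hBL] at hBS ⊢
    left
    have hI : insert (n + 1) (L ∩ Finset.Icc 1 b) = L := by
      ext x
      simp only [Finset.mem_insert, Finset.mem_inter, Finset.mem_Icc]
      grind
    rcases Nat.eq_zero_or_pos b with h0 | h0
    · have : blockOf (restrictTo P (Finset.Icc 1 b)) b = L ∩ Finset.Icc 1 b := by
        rcases hQ.blockOf_cases with h' | h'
        · have := hQ.subset h'.1 h'.2
          simp at this
          omega
        · rw [h'.1, h0]
          simp
      rw [this, hI]
    · have hbI : b ∈ L ∩ Finset.Icc 1 b := by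
        simp only [Finset.mem_inter, Finset.mem_Icc]
        exact ⟨hbL h0, h0, le_rfl⟩
      rw [hQ.blockOf_eq (mem_restrictTo.2 ⟨⟨b, hbI⟩, L, hL, rfl⟩) hbI, hI]
  · right
    have hdis : ∀ x ∈ B, x ∉ L := fun x hx hx' => hBL (h.eq_of_mem B hB L hL x hx hx')
    by_cases hlow : ∃ x ∈ B, x ≤ b
    · left
      obtain ⟨x, hx, hxb⟩ := hlow
      have hbB : b ∉ B := fun hb' => hdis b hb' (hbL (by have := hBS x hx; omega))
      refine ⟨mem_restrictTo.2 ⟨h.nonempty B hB, B, hB, ?_⟩, hbB⟩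
      refine Finset.inter_eq_left.2 fun y hy => Finset.mem_Icc.2 ⟨(hBS y hy).1, ?_⟩
      by_contra! hyb
      have hxb' : x < b := lt_of_le_of_ne hxb (fun e => hbB (e ▸ hx))
      have hyn : y < n + 1 := lt_of_le_of_ne (hBS y hy).2 (fun e => hdis y hy (e ▸ hm))
      exact h.nonCrossing B hB L hL hBL x b y (n + 1) hxb' hyb hyn hx hy
        (hbL (by have := hBS x hx; omega)) hm
    · right
      push Not at hlow
      refine mem_restrictTo.2 ⟨h.nonempty B hB, B, hB, ?_⟩
      refine Finset.inter_eq_left.2 fun y hy => Finset.mem_Ioc.2 ⟨hlow y hy, ?_⟩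
      have hyn : y ≠ n + 1 := fun e => hdis y hy (e ▸ hm)
      have := hBS y hy
      omega

theorem IsNC.image {S : Finset ℕ} {P : Finset (Finset ℕ)} (h : IsNC S P) {f : ℕ → ℕ}
    (hf : StrictMonoOn f S) : IsNC (S.image f) (P.image (Finset.image f)) := by
  have key : ∀ B ∈ P, ∀ B' ∈ P, ∀ x ∈ B, ∀ y ∈ B', f x = f y → x = y := fun B hB B' hB' x hx y hy =>
    hf.injOn (h.subset hB hx) (h.subset hB' hy)
  refine ⟨?_, ?_, ?_, ?_⟩
  · intro D hD
    obtain ⟨B, hB, rfl⟩ := Finset.mem_image.1 hD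
    exact (h.nonempty B hB).image f
  · intro x
    simp only [Finset.mem_image, h.mem_iff]
    constructor
    · rintro ⟨y, ⟨B, hB, hy⟩, rfl⟩
      exact ⟨_, ⟨B, hB, rfl⟩, Finset.mem_image_of_mem f hy⟩
    · rintro ⟨_, ⟨B, hB, rfl⟩, hx⟩
      obtain ⟨y, hy, rfl⟩ := Finset.mem_image.1 hx
      exact ⟨y, ⟨B, hB, hy⟩, rfl⟩
  · intro D hD D' hD' x hx hx'
    obtain ⟨B, hB, rfl⟩ := Finset.mem_image.1 hD
    obtain ⟨B', hB', rfl⟩ := Finset.mem_image.1 hD'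
    obtain ⟨y, hy, rfl⟩ := Finset.mem_image.1 hx
    obtain ⟨z, hz, hzy⟩ := Finset.mem_image.1 hx'
    obtain rfl := key B' hB' B hB z hz y hy hzy
    rw [h.eq_of_mem B hB B' hB' z hy hz]
  · intro D hD D' hD' hne a b c d hab hbc hcd ha hc hb hd
    obtain ⟨B, hB, rfl⟩ := Finset.mem_image.1 hD
    obtain ⟨B', hB', rfl⟩ := Finset.mem_image.1 hD'
    obtain ⟨a, ha', rfl⟩ := Finset.mem_image.1 ha
    obtain ⟨b, hb', rfl⟩ := Finset.mem_image.1 hb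
    obtain ⟨c, hc', rfl⟩ := Finset.mem_image.1 hc
    obtain ⟨d, hd', rfl⟩ := Finset.mem_image.1 hd
    have sB := h.subset hB
    have sB' := h.subset hB'
    exact h.nonCrossing B hB B' hB' (fun e => hne (by rw [e])) a b c d
      ((hf.lt_iff_lt (sB ha') (sB' hb')).1 hab) ((hf.lt_iff_lt (sB' hb') (sB hc')).1 hbc)
      ((hf.lt_iff_lt (sB hc') (sB' hd')).1 hcd) ha' hc' hb' hd'

theorem IsNC.image_image {S : Finset ℕ} {P : Finset (Finset ℕ)} (h : IsNC S P) {f g : ℕ → ℕ}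
    (hg : ∀ x ∈ S, g (f x) = x) : (P.image (Finset.image f)).image (Finset.image g) = P := by
  rw [Finset.image_image]
  have : ∀ B ∈ P, (Finset.image g ∘ Finset.image f) B = B := by
    intro B hB
    rw [Function.comp, Finset.image_image]
    have hB' : ∀ x ∈ B, (g ∘ f) x = id x := fun x hx => hg x (h.subset hB hx)
    rw [Finset.image_congr hB', Finset.image_id]
  rw [Finset.image_congr (g := id) this, Finset.image_id]

theorem IsNC.OmegaP_image {S : Finset ℕ} {P : Finset (Finset ℕ)} (h : IsNC S P) {f g : ℕ → ℕ}
    (hg : ∀ x ∈ S, g (f x) = x) (v : ℕ → ℝ) :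
    OmegaP v (P.image (Finset.image f)) = OmegaP v P := by
  have hinj : ∀ B ∈ P, (B.image f).image g = B := by
    intro B hB
    rw [Finset.image_image]
    have hB' : ∀ x ∈ B, (g ∘ f) x = id x := fun x hx => hg x (h.subset hB hx)
    rw [Finset.image_congr hB', Finset.image_id]
  rw [OmegaP, Finset.prod_image]
  · refine Finset.prod_congr rfl fun B hB => ?_
    rw [Finset.card_image_of_injOn]
    intro x hx y hy hxy
    rw [← hg x (h.subset hB hx), ← hg y (h.subset hB hy), hxy]
  · intro B hB B' hB' he
    rw [← hinj B hB, ← hinj B' hB', he]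

theorem sum_ncOn_Ioc (v : ℕ → ℝ) {b n : ℕ} (hbn : b ≤ n) :
    ∑ R ∈ ncOn (Finset.Ioc b n), OmegaP v R = Zw v (n - b) := by
  have h1 : (Finset.Ioc b n).image (· - b) = Finset.Icc 1 (n - b) := by
    ext x
    simp only [Finset.mem_image, Finset.mem_Ioc, Finset.mem_Icc]
    exact ⟨by rintro ⟨y, hy, rfl⟩; omega, fun hx => ⟨x + b, by omega, by omega⟩⟩
  have h2 : (Finset.Icc 1 (n - b)).image (· + b) = Finset.Ioc b n := by
    ext x
    simp only [Finset.mem_image, Finset.mem_Ioc, Finset.mem_Icc]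
    exact ⟨by rintro ⟨y, hy, rfl⟩; omega, fun hx => ⟨x - b, by omega, by omega⟩⟩
  have m1 : StrictMonoOn (· - b) (Finset.Ioc b n : Set ℕ) := fun x hx y hy hxy => by
    simp only [Finset.coe_Ioc, Set.mem_Ioc] at hx hy
    simp only
    omega
  have m2 : StrictMonoOn (· + b) (Finset.Icc 1 (n - b) : Set ℕ) := fun x _ y _ hxy => by
    simp only
    omega
  have i1 : ∀ x ∈ Finset.Ioc b n, x - b + b = x := fun x hx => by
    rw [Finset.mem_Ioc] at hx
    omega
  have i2 : ∀ x ∈ Finset.Icc 1 (n - b), x + b - b = x := fun x _ => by omega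
  rw [Zw, NCP_eq_ncOn]
  refine Finset.sum_nbij' (fun P => P.image (Finset.image (· - b)))
    (fun P => P.image (Finset.image (· + b))) ?_ ?_ ?_ ?_ ?_
  · exact fun P hP => mem_ncOn.2 (h1 ▸ (mem_ncOn.1 hP).image m1)
  · exact fun P hP => mem_ncOn.2 (h2 ▸ (mem_ncOn.1 hP).image m2)
  · exact fun P hP => (mem_ncOn.1 hP).image_image i1
  · exact fun P hP => (mem_ncOn.1 hP).image_image i2
  · exact fun P hP => ((mem_ncOn.1 hP).OmegaP_image (g := (· + b)) i1 v).symm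

/-- The weight of a partition of `[n]` in which the block of `n` is given `j` extra points. -/
noncomputable def markedWeight (v : ℕ → ℝ) (j n : ℕ) (P : Finset (Finset ℕ)) : ℝ :=
  v ((blockOf P n).card + j) * ∏ B ∈ P.filter (n ∉ ·), v B.card

/-- The partition function with `j` extra points in the block of `n`. -/
noncomputable def markedZ (v : ℕ → ℝ) (j n : ℕ) : ℝ :=
  ∑ P ∈ NCP n, markedWeight v j n P

theorem NCP_zero : NCP 0 = {∅} := by
  ext P
  rw [mem_NCP, Finset.mem_singleton]
  constructor
  · intro h
    refine Finset.eq_empty_of_forall_notMem fun B hB => ?_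
    obtain ⟨x, hx⟩ := h.nonempty B hB
    simpa using h.subset hB hx
  · rintro rfl
    exact ⟨by simp, by simp, by simp, by simp [IsNonCrossing]⟩

theorem Zw_zero (v : ℕ → ℝ) : Zw v 0 = 1 := by
  simp [Zw, NCP_zero, OmegaP]

theorem markedZ_zero_right (v : ℕ → ℝ) (j : ℕ) : markedZ v j 0 = v j := by
  simp [markedZ, NCP_zero, markedWeight, blockOf]

theorem markedZ_zero_left {v : ℕ → ℝ} (hv : v 0 = 1) (n : ℕ) : markedZ v 0 n = Zw v n := by
  rcases Nat.eq_zero_or_pos n with rfl | hn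
  · rw [markedZ_zero_right, Zw_zero, hv]
  · refine Finset.sum_congr rfl fun P hP => ?_
    have h := mem_NCP.1 hP
    obtain ⟨hL, hm⟩ := h.blockOf_mem (m := n) (by simp; omega)
    rw [OmegaP, ← Finset.prod_filter_mul_prod_filter_not P (n ∈ ·), h.filter_mem_eq hL hm,
      Finset.prod_singleton, markedWeight, add_zero]

theorem IsNC.markedWeight_joinAt (v : ℕ → ℝ) (j : ℕ) {b n : ℕ} (hbn : b ≤ n)
    {Q R : Finset (Finset ℕ)} (hQ : IsNC (Finset.Icc 1 b) Q) (hR : IsNC (Finset.Ioc b n) R) :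
    markedWeight v j (n + 1) (joinAt b (n + 1) Q R) =
      markedWeight v (j + 1) b Q * OmegaP v R := by
  have hL := hQ.blockOf_le
  have hn : n + 1 ∉ blockOf Q b := fun h => by have := hL _ h; omega
  have hf : (joinAt b (n + 1) Q R).filter (n + 1 ∉ ·) = Q.filter (b ∉ ·) ∪ R := by
    rw [joinAt, Finset.filter_insert, if_neg (by simp), Finset.filter_true_of_mem]
    intro B hB hnB
    rcases Finset.mem_union.1 hB with h | h
    · have := hQ.subset (Finset.mem_filter.1 h).1 hnB
      simp only [Finset.mem_Icc] at this
      omega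
    · have := hR.subset h hnB
      simp only [Finset.mem_Ioc] at this
      omega
  have hd : Disjoint (Q.filter (b ∉ ·)) R := by
    refine Finset.disjoint_left.2 fun B hB hB' => ?_
    have hBQ := (Finset.mem_filter.1 hB).1
    obtain ⟨x, hx⟩ := hQ.nonempty B hBQ
    have h1 := hQ.subset hBQ hx
    have h2 := hR.subset hB' hx
    simp only [Finset.mem_Icc, Finset.mem_Ioc] at h1 h2
    omega
  rw [markedWeight, markedWeight, OmegaP, hQ.joinAt_blockOf hbn hR, hf,
    Finset.card_insert_of_notMem hn, Finset.prod_union hd, mul_assoc, add_assoc, add_comm 1 j]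

/-- Decomposition of a partition of `[n + 1]` at the predecessor of `n + 1` in its block. -/
theorem markedZ_succ (v : ℕ → ℝ) (j n : ℕ) :
    markedZ v j (n + 1) =
      ∑ b ∈ Finset.range (n + 1), markedZ v (j + 1) b * Zw v (n - b) := by
  rw [markedZ, ← Finset.sum_fiberwise_of_maps_to (g := fun P => prevOf P (n + 1))
    (t := Finset.range (n + 1)) fun P hP => Finset.mem_range.2 (mem_NCP.1 hP).prevOf_lt]
  refine Finset.sum_congr rfl fun b hb => ?_
  have hbn : b ≤ n := Nat.lt_succ_iff.1 (Finset.mem_range.1 hb)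
  rw [← sum_ncOn_Ioc v hbn, markedZ, Finset.sum_mul_sum, ← Finset.sum_product']
  refine Finset.sum_nbij'
    (fun P => (restrictTo P (Finset.Icc 1 b), restrictTo P (Finset.Ioc b n)))
    (fun q => joinAt b (n + 1) q.1 q.2) ?_ ?_ ?_ ?_ ?_
  · intro P hP
    rw [Finset.mem_filter] at hP
    have h := mem_NCP.1 hP.1
    rw [Finset.mem_product, mem_NCP, mem_ncOn]
    exact ⟨h.isNC_restrictTo (Finset.Icc_subset_Icc_right (by omega)),
      h.isNC_restrictTo fun x hx => by simp at hx ⊢; omega⟩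
  · rintro ⟨Q, R⟩ hq
    rw [Finset.mem_product, mem_NCP, mem_ncOn] at hq
    rw [Finset.mem_filter, mem_NCP]
    exact ⟨hq.1.isNC_joinAt hbn hq.2, hq.1.prevOf_joinAt hbn hq.2⟩
  · intro P hP
    rw [Finset.mem_filter] at hP
    have h := (mem_NCP.1 hP.1).joinAt_restrictTo
    rwa [hP.2] at h
  · rintro ⟨Q, R⟩ hq
    rw [Finset.mem_product, mem_NCP, mem_ncOn] at hq
    exact Prod.ext (hq.1.restrictTo_joinAt_left hbn hq.2) (hq.1.restrictTo_joinAt_right hbn hq.2)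
  · intro P hP
    rw [Finset.mem_filter] at hP
    have h := mem_NCP.1 hP.1
    have hj := h.joinAt_restrictTo
    rw [hP.2] at hj
    conv_lhs => rw [← hj]
    exact (h.isNC_restrictTo (Finset.Icc_subset_Icc_right (by omega))).markedWeight_joinAt v j hbn
      (h.isNC_restrictTo fun x hx => by simp at hx ⊢; omega)

theorem markedZ_nonneg {v : ℕ → ℝ} (hv : ∀ k, 0 ≤ v k) (j n : ℕ) : 0 ≤ markedZ v j n :=
  Finset.sum_nonneg fun _ _ => mul_nonneg (hv _) (Finset.prod_nonneg fun _ _ => hv _)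

theorem OmegaP_nonneg {v : ℕ → ℝ} (hv : ∀ k, 0 ≤ v k) (P : Finset (Finset ℕ)) :
    0 ≤ OmegaP v P :=
  Finset.prod_nonneg fun _ _ => hv _

theorem Zw_nonneg {v : ℕ → ℝ} (hv : ∀ k, 0 ≤ v k) (n : ℕ) : 0 ≤ Zw v n :=
  Finset.sum_nonneg fun _ _ => OmegaP_nonneg hv _

theorem Zw_mul_le {v : ℕ → ℝ} (hv0 : v 0 = 1) (hv : ∀ k, 0 ≤ v k) (n m : ℕ) :
    Zw v n * Zw v m ≤ Zw v (n + m) := by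
  induction n using Nat.strong_induction_on with
  | _ n ih =>
    rcases n with _ | n
    · rw [Zw_zero, one_mul, zero_add]
    · rw [← markedZ_zero_left hv0 (n + 1), ← markedZ_zero_left hv0 (n + 1 + m),
        show n + 1 + m = n + m + 1 by ring, markedZ_succ, markedZ_succ, Finset.sum_mul]
      refine le_trans (Finset.sum_le_sum fun b hb => ?_) (Finset.sum_le_sum_of_subset_of_nonneg
        (Finset.range_mono (show n + 1 ≤ n + m + 1 by omega)) fun b _ _ =>
          mul_nonneg (markedZ_nonneg hv _ _) (Zw_nonneg hv _))
      have hbn : b ≤ n := Nat.lt_succ_iff.1 (Finset.mem_range.1 hb)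
      rw [mul_assoc, show n + m - b = n - b + m by omega]
      exact mul_le_mul_of_nonneg_left (ih (n - b) (by omega)) (markedZ_nonneg hv _ _)

theorem le_markedZ {v : ℕ → ℝ} (hv : ∀ k, 0 ≤ v k) (j n : ℕ) : v (j + n) ≤ markedZ v j n := by
  induction n generalizing j with
  | zero => rw [markedZ_zero_right, add_zero]
  | succ n ih =>
    rw [markedZ_succ, show j + (n + 1) = j + 1 + n by ring]
    refine (ih (j + 1)).trans ?_
    have := Finset.single_le_sum
      (f := fun b => markedZ v (j + 1) b * Zw v (n - b))
      (fun b _ => mul_nonneg (markedZ_nonneg hv _ _) (Zw_nonneg hv _)) (Finset.self_mem_range_succ n)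
    simpa [Zw_zero] using this

theorem le_Zw {v : ℕ → ℝ} (hv0 : v 0 = 1) (hv : ∀ k, 0 ≤ v k) (n : ℕ) : v n ≤ Zw v n := by
  simpa [markedZ_zero_left hv0] using le_markedZ hv 0 n

theorem prod_le_Zw {v : ℕ → ℝ} (hv0 : v 0 = 1) (hv : ∀ k, 0 ≤ v k) (F : Finset (Finset ℕ)) :
    ∏ B ∈ F, v B.card ≤ Zw v (∑ B ∈ F, B.card) := by
  induction F using Finset.induction_on with
  | empty => simp [Zw_zero]
  | insert B F hB ih =>
    rw [Finset.prod_insert hB, Finset.sum_insert hB]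
    exact (mul_le_mul (le_Zw hv0 hv _) ih (Finset.prod_nonneg fun _ _ => hv _)
      (Zw_nonneg hv _)).trans (Zw_mul_le hv0 hv _ _)

theorem Zw_pow_le {v : ℕ → ℝ} (hv0 : v 0 = 1) (hv : ∀ k, 0 ≤ v k) (m q : ℕ) :
    Zw v m ^ q ≤ Zw v (m * q) := by
  induction q with
  | zero => simp [Zw_zero]
  | succ q ih =>
    rw [pow_succ, Nat.mul_succ]
    exact (mul_le_mul_of_nonneg_right ih (Zw_nonneg hv _)).trans (Zw_mul_le hv0 hv _ _)

theorem sum_range_convolution (f g : ℕ → ℝ) (N : ℕ) :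
    ∑ n ∈ Finset.range N, ∑ b ∈ Finset.range (n + 1), f b * g (n - b) =
      ∑ b ∈ Finset.range N, f b * ∑ c ∈ Finset.range (N - b), g c := by
  rw [Finset.sum_comm' (t' := Finset.range N) (s' := fun b => Finset.Ico b N)
    fun n b => by simp only [Finset.mem_range, Finset.mem_Ico]; omega]
  refine Finset.sum_congr rfl fun b _ => ?_
  rw [Finset.sum_Ico_eq_sum_range, Finset.mul_sum]
  simp

theorem sum_range_convolution_le {f g : ℕ → ℝ} (hf : ∀ n, 0 ≤ f n) (hg : ∀ n, 0 ≤ g n) (N : ℕ) :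
    ∑ n ∈ Finset.range N, ∑ b ∈ Finset.range (n + 1), f b * g (n - b) ≤
      (∑ b ∈ Finset.range N, f b) * ∑ c ∈ Finset.range N, g c := by
  rw [sum_range_convolution, Finset.sum_mul]
  exact Finset.sum_le_sum fun b _ => mul_le_mul_of_nonneg_left
    (Finset.sum_le_sum_of_subset_of_nonneg (Finset.range_mono (Nat.sub_le N b))
      fun c _ _ => hg c) (hf b)

theorem le_sum_range_convolution {f g : ℕ → ℝ} (hf : ∀ n, 0 ≤ f n) (hg : ∀ n, 0 ≤ g n)
    (M N : ℕ) :
    (∑ b ∈ Finset.range M, f b) * ∑ c ∈ Finset.range N, g c ≤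
      ∑ n ∈ Finset.range (M + N), ∑ b ∈ Finset.range (n + 1), f b * g (n - b) := by
  rw [sum_range_convolution, Finset.sum_mul]
  refine le_trans (Finset.sum_le_sum fun b hb => mul_le_mul_of_nonneg_left
    (Finset.sum_le_sum_of_subset_of_nonneg (Finset.range_mono (?_ : N ≤ M + N - b))
      fun c _ _ => hg c) (hf b)) (Finset.sum_le_sum_of_subset_of_nonneg
        (Finset.range_mono (Nat.le_add_right M N))
        fun b _ _ => mul_nonneg (hf b) (Finset.sum_nonneg fun c _ => hg c))
  have := Finset.mem_range.1 hb
  omega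

theorem sum_range_markedZ_succ (v : ℕ → ℝ) (x : ℝ) (j N : ℕ) :
    ∑ n ∈ Finset.range (N + 1), markedZ v j n * x ^ n =
      v j + x * ∑ n ∈ Finset.range N, ∑ b ∈ Finset.range (n + 1),
        (markedZ v (j + 1) b * x ^ b) * (Zw v (n - b) * x ^ (n - b)) := by
  rw [Finset.sum_range_succ', markedZ_zero_right, pow_zero, mul_one, add_comm, Finset.mul_sum]
  congr 1
  refine Finset.sum_congr rfl fun n _ => ?_
  rw [markedZ_succ, Finset.sum_mul, Finset.mul_sum]
  refine Finset.sum_congr rfl fun b hb => ?_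
  have hbn : b ≤ n := Nat.lt_succ_iff.1 (Finset.mem_range.1 hb)
  have hx : x ^ (n + 1) = x * (x ^ b * x ^ (n - b)) := by
    rw [← pow_add, Nat.add_sub_cancel' hbn, pow_succ']
  rw [hx]
  ring

theorem Zw_le_of_summable {v : ℕ → ℝ} (hv0 : v 0 = 1) (hv : ∀ k, 0 ≤ v k)
    {ξ : ℝ} (hξ : 0 < ξ) (hs : Summable fun k => v k * ξ ^ k) (n : ℕ) :
    Zw v n ≤ (∑' k, v k * ξ ^ k) * ((∑' k, v k * ξ ^ k) / ξ) ^ n := by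
  set S := ∑' k, v k * ξ ^ k with hS
  have hS0 : 0 < S := by
    refine lt_of_lt_of_le one_pos ?_
    simpa [hv0] using hs.le_tsum 0 fun k _ => mul_nonneg (hv k) (pow_nonneg hξ.le k)
  set x := ξ / S with hx
  have hx0 : 0 < x := div_pos hξ hS0
  have hsj : ∀ j, Summable fun k => v (j + k) * ξ ^ k := by
    intro j
    have h := ((summable_nat_add_iff j).2 hs).mul_right (ξ ^ j)⁻¹
    refine h.congr fun k => ?_
    rw [pow_add, add_comm k j]
    field_simp
  have hZ : ∀ n, 0 ≤ Zw v n * x ^ n := fun n => mul_nonneg (Zw_nonneg hv n) (pow_nonneg hx0.le n)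
  have hT : ∀ j n, 0 ≤ markedZ v j n * x ^ n := fun j n =>
    mul_nonneg (markedZ_nonneg hv j n) (pow_nonneg hx0.le n)
  have key : ∀ N j, ∑ n ∈ Finset.range N, markedZ v j n * x ^ n ≤ ∑' k, v (j + k) * ξ ^ k := by
    intro N
    induction N with
    | zero =>
      intro j
      simpa using tsum_nonneg fun k => mul_nonneg (hv (j + k)) (pow_nonneg hξ.le k)
    | succ N ih =>
      intro j
      have h0 : x * ∑ n ∈ Finset.range N, Zw v n * x ^ n ≤ ξ := by
        have h := ih 0
        simp only [markedZ_zero_left hv0, zero_add] at h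
        calc _ ≤ x * S := mul_le_mul_of_nonneg_left h hx0.le
          _ = ξ := by rw [hx]; field_simp
      rw [sum_range_markedZ_succ, (hsj j).tsum_eq_zero_add]
      have e : ∀ k, v (j + (k + 1)) * ξ ^ (k + 1) = (v (j + 1 + k) * ξ ^ k) * ξ := fun k => by
        rw [show j + (k + 1) = j + 1 + k by ring]
        ring
      simp only [e, tsum_mul_right, add_zero, pow_zero, mul_one]
      refine add_le_add le_rfl ?_
      calc _ ≤ x * ((∑ n ∈ Finset.range N, markedZ v (j + 1) n * x ^ n) *
              ∑ n ∈ Finset.range N, Zw v n * x ^ n) :=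
            mul_le_mul_of_nonneg_left (sum_range_convolution_le (hT (j + 1)) hZ N) hx0.le
        _ = (∑ n ∈ Finset.range N, markedZ v (j + 1) n * x ^ n) *
              (x * ∑ n ∈ Finset.range N, Zw v n * x ^ n) := by ring
        _ ≤ _ := mul_le_mul (ih (j + 1)) h0
            (mul_nonneg hx0.le (Finset.sum_nonneg fun n _ => hZ n))
            (tsum_nonneg fun k => mul_nonneg (hv _) (pow_nonneg hξ.le k))
  have h := (Finset.single_le_sum (fun n _ => hT 0 n) (Finset.self_mem_range_succ n)).trans
    (key (n + 1) 0)
  simp only [markedZ_zero_left hv0, zero_add] at h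
  rw [← hS, ← le_div_iff₀ (pow_pos hx0 n)] at h
  rw [← inv_div ξ S, ← hx, inv_pow, ← div_eq_mul_inv]
  exact h

theorem mul_tsum_le_of_summable_Zw {v : ℕ → ℝ} (hv0 : v 0 = 1) (hv : ∀ k, 0 ≤ v k)
    {x : ℝ} (hx : 0 < x) (hs : Summable fun n => Zw v n * x ^ n) :
    (Summable fun k => v k * (x * ∑' n, Zw v n * x ^ n) ^ k) ∧
      x * ∑' k, v k * (x * ∑' n, Zw v n * x ^ n) ^ k ≤ x * ∑' n, Zw v n * x ^ n := by
  have hZ : ∀ n, 0 ≤ Zw v n * x ^ n := fun n => mul_nonneg (Zw_nonneg hv n) (pow_nonneg hx.le n)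
  have hT : ∀ j n, 0 ≤ markedZ v j n * x ^ n := fun j n =>
    mul_nonneg (markedZ_nonneg hv j n) (pow_nonneg hx.le n)
  have key : ∀ K N j, ∃ M, ∑ k ∈ Finset.range K,
      v (j + k) * (x * ∑ n ∈ Finset.range N, Zw v n * x ^ n) ^ k ≤
        ∑ n ∈ Finset.range M, markedZ v j n * x ^ n := by
    intro K N
    induction K with
    | zero => exact fun j => ⟨0, by simp⟩
    | succ K ih =>
      intro j
      obtain ⟨M, hM⟩ := ih (j + 1)
      refine ⟨M + N + 1, ?_⟩
      set y := x * ∑ n ∈ Finset.range N, Zw v n * x ^ n with hy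
      have hy0 : 0 ≤ y := mul_nonneg hx.le (Finset.sum_nonneg fun n _ => hZ n)
      have e : ∀ k, v (j + (k + 1)) * y ^ (k + 1) = (v (j + 1 + k) * y ^ k) * y := fun k => by
        rw [show j + (k + 1) = j + 1 + k by ring]
        ring
      rw [sum_range_markedZ_succ, Finset.sum_range_succ', add_comm]
      simp only [e, ← Finset.sum_mul, add_zero, pow_zero, mul_one]
      refine add_le_add le_rfl ?_
      calc _ ≤ (∑ n ∈ Finset.range M, markedZ v (j + 1) n * x ^ n) * y :=
            mul_le_mul_of_nonneg_right hM hy0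
        _ = x * ((∑ n ∈ Finset.range M, markedZ v (j + 1) n * x ^ n) *
              ∑ n ∈ Finset.range N, Zw v n * x ^ n) := by rw [hy]; ring
        _ ≤ _ := mul_le_mul_of_nonneg_left (le_sum_range_convolution (hT (j + 1)) hZ M N) hx.le
  set Y := ∑' n, Zw v n * x ^ n with hY
  have hY0 : 0 ≤ Y := tsum_nonneg hZ
  have bound : ∀ K, ∑ k ∈ Finset.range K, v k * (x * Y) ^ k ≤ Y := by
    intro K
    have ht : Filter.Tendsto (fun N => ∑ k ∈ Finset.range K,
        v k * (x * ∑ n ∈ Finset.range N, Zw v n * x ^ n) ^ k) Filter.atTop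
        (nhds (∑ k ∈ Finset.range K, v k * (x * Y) ^ k)) :=
      tendsto_finsetSum _ fun k _ =>
        ((hs.hasSum.tendsto_sum_nat.const_mul x).pow k).const_mul (v k)
    refine le_of_tendsto' ht fun N => ?_
    obtain ⟨M, hM⟩ := key K N 0
    simp only [markedZ_zero_left hv0, zero_add] at hM
    exact hM.trans (hs.sum_le_tsum _ fun n _ => hZ n)
  have hnn : ∀ k, 0 ≤ v k * (x * Y) ^ k := fun k =>
    mul_nonneg (hv k) (pow_nonneg (mul_nonneg hx.le hY0) k)
  exact ⟨summable_of_sum_range_le hnn bound,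
    mul_le_mul_of_nonneg_left (Real.tsum_le_of_sum_range_le hnn bound) hx.le⟩

theorem exists_pow_lt_Zw {v : ℕ → ℝ} (hv0 : v 0 = 1) (hv : ∀ k, 0 ≤ v k)
    {L L' : ℝ} (hL : 0 < L) (hLL : L < L')
    (h : ∀ y, 0 < y → (Summable fun k => v k * y ^ k) → L' * y ≤ ∑' k, v k * y ^ k) :
    ∃ m, L ^ m < Zw v m := by
  by_contra! hcon
  set x := 2 / (L + L') with hx
  have hx0 : 0 < x := div_pos two_pos (by linarith)
  have hxL : L * x < 1 := by
    rw [hx, ← mul_div_assoc, div_lt_one (by linarith)]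
    linarith
  have hxL' : 1 < L' * x := by
    rw [hx, ← mul_div_assoc, one_lt_div (by linarith)]
    linarith
  have hZ : ∀ n, 0 ≤ Zw v n * x ^ n := fun n => mul_nonneg (Zw_nonneg hv n) (pow_nonneg hx0.le n)
  have hs : Summable fun n => Zw v n * x ^ n := by
    refine Summable.of_nonneg_of_le hZ (fun n => ?_)
      (summable_geometric_of_lt_one (by positivity) hxL)
    rw [mul_pow]
    exact mul_le_mul_of_nonneg_right (hcon n) (by positivity)
  obtain ⟨h1, h2⟩ := mul_tsum_le_of_summable_Zw hv0 hv hx0 hs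
  have hY : 1 ≤ ∑' n, Zw v n * x ^ n := by
    simpa [Zw_zero] using hs.le_tsum 0 fun n _ => hZ n
  set y := x * ∑' n, Zw v n * x ^ n with hy
  have hy0 : 0 < y := by positivity
  have h3 := h y hy0 h1
  have h4 : x * (L' * y) ≤ y := (mul_le_mul_of_nonneg_left h3 hx0.le).trans h2
  nlinarith [mul_pos (sub_pos.2 hxL') hy0]

theorem exists_forall_mul_pow_le_Zw {v : ℕ → ℝ} (hv0 : v 0 = 1) (hv : ∀ k, 0 ≤ v k)
    {L L' : ℝ} (hL : 0 < L) (hLL : L < L')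
    (h : ∀ y, 0 < y → (Summable fun k => v k * y ^ k) → L' * y ≤ ∑' k, v k * y ^ k) :
    ∃ c, 0 < c ∧ ∀ n, 0 < Zw v n → c * L ^ n ≤ Zw v n := by
  obtain ⟨m, hm⟩ := exists_pow_lt_Zw hv0 hv hL hLL h
  have hm0 : 0 < m := by
    rcases Nat.eq_zero_or_pos m with rfl | h
    · simp [Zw_zero] at hm
    · exact h
  have hr : ∀ r, ∃ c, 0 < c ∧ ∀ n, n % m = r → 0 < Zw v n → c * L ^ n ≤ Zw v n := by
    intro r
    by_cases hex : ∃ n, n % m = r ∧ 0 < Zw v n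
    · set a := Nat.find hex
      obtain ⟨ha, haZ⟩ := Nat.find_spec hex
      refine ⟨Zw v a / L ^ a, by positivity, fun n hn hnZ => ?_⟩
      have hle : a ≤ n := Nat.find_min' hex ⟨hn, hnZ⟩
      obtain ⟨q, hq⟩ := (Nat.modEq_iff_dvd' hle).1 (ha.trans hn.symm)
      obtain rfl : n = a + m * q := by omega
      calc Zw v a / L ^ a * L ^ (a + m * q) = Zw v a * (L ^ m) ^ q := by
            rw [pow_add, ← pow_mul]
            field_simp
        _ ≤ Zw v a * Zw v m ^ q := by gcongr
        _ ≤ Zw v a * Zw v (m * q) := by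
            gcongr
            exact Zw_pow_le hv0 hv m q
        _ ≤ _ := Zw_mul_le hv0 hv _ _
    · push Not at hex
      exact ⟨1, one_pos, fun n hn hnZ => absurd hnZ (not_lt.2 (hex n hn))⟩
  choose c hc0 hc using hr
  have hne : (Finset.range m).Nonempty := Finset.nonempty_range_iff.2 hm0.ne'
  refine ⟨(Finset.range m).inf' hne c, (Finset.lt_inf'_iff hne).2 fun r _ => hc0 r,
    fun n hn => le_trans ?_ (hc (n % m) n rfl hn)⟩
  exact mul_le_mul_of_nonneg_right
    (Finset.inf'_le c (Finset.mem_range.2 (Nat.mod_lt n hm0))) (by positivity)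

theorem wLimsup_le_of_summable {w : ℕ → ℝ} (hw : ∀ k, 0 ≤ w k) {y : ℝ} (hy : 0 < y)
    (hs : Summable fun k => w k * y ^ k) : wLimsup w ≤ ENNReal.ofReal (1 / y) := by
  refine Filter.limsup_le_of_le (by isBoundedDefault) ?_
  filter_upwards [hs.tendsto_atTop_zero.eventually (ge_mem_nhds one_pos),
    Filter.eventually_ge_atTop 1] with k hk hk1
  refine ENNReal.ofReal_le_ofReal ?_
  have hk0 : (k : ℝ) ≠ 0 := by positivity
  have h1 : w k ≤ (1 / y) ^ k := by
    rwa [one_div, inv_pow, ← one_div, le_div_iff₀ (pow_pos hy k)]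
  calc w k ^ (1 / (k : ℝ)) ≤ ((1 / y) ^ k) ^ (1 / (k : ℝ)) :=
        Real.rpow_le_rpow (hw k) h1 (by positivity)
    _ = 1 / y := by
        rw [← Real.rpow_natCast, ← Real.rpow_mul (by positivity), mul_one_div_cancel hk0,
          Real.rpow_one]

theorem tsum_add_mul_sub_le {w : ℕ → ℝ} (hw : ∀ k, 0 ≤ w k) {ξ y : ℝ} (hξ : 0 < ξ) (hy : 0 < y)
    (hsξ : Summable fun k => w k * ξ ^ k) (hs' : Summable fun k : ℕ => (k : ℝ) * w k * ξ ^ k)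
    (hsy : Summable fun k => w k * y ^ k) :
    ∑' k, w k * ξ ^ k + (∑' k : ℕ, (k : ℝ) * w k * ξ ^ k) * (y / ξ - 1) ≤ ∑' k, w k * y ^ k := by
  rw [← tsum_mul_right, ← hsξ.tsum_add (hs'.mul_right _)]
  refine (hsξ.add (hs'.mul_right _)).tsum_le_tsum (fun k => ?_) hsy
  have hb := one_add_mul_le_pow (a := y / ξ - 1) (by have := div_pos hy hξ; linarith) k
  rw [add_sub_cancel, div_pow, le_div_iff₀ (pow_pos hξ k)] at hb
  nlinarith [mul_le_mul_of_nonneg_left hb (hw k)]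

/-- The number of blocks of `P` whose size lies in `C`. -/
noncomputable def blockCount (C : Set ℕ) (P : Finset (Finset ℕ)) : ℕ :=
  (P.filter fun B => B.card ∈ C).card

theorem IsNC.card_le {S : Finset ℕ} {P : Finset (Finset ℕ)} (h : IsNC S P) : P.card ≤ S.card := by
  rw [← h.sum_card, Finset.card_eq_sum_ones]
  exact Finset.sum_le_sum fun B hB => (h.nonempty B hB).card_pos

theorem blockCount_le {n : ℕ} {P : Finset (Finset ℕ)} (hP : P ∈ NCP n) (C : Set ℕ) :
    blockCount C P ≤ n := by
  have h := (mem_NCP.1 hP).card_le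
  rw [Nat.card_Icc, Nat.add_sub_cancel] at h
  exact (Finset.card_filter_le _ _).trans h

theorem OmegaP_tilt (w : ℕ → ℝ) (C : Set ℕ) (a : ℝ) (P : Finset (Finset ℕ)) :
    OmegaP (fun k => w k * if k ∈ C then a else 1) P = OmegaP w P * a ^ blockCount C P := by
  rw [OmegaP, Finset.prod_mul_distrib, OmegaP, blockCount, ← Finset.prod_filter, Finset.prod_const]

/-- The `Ω^w`-mass of the partitions for which `ζ_C / n` is not within `ε` of `p`. -/
noncomputable def deviationMass (w : ℕ → ℝ) (C : Set ℕ) (p ε : ℝ) (n : ℕ) : ℝ :=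
  ∑ P ∈ (NCP n).filter fun P => ε < |(blockCount C P : ℝ) / (n : ℝ) - p|, OmegaP w P

theorem deviationMass_nonneg {w : ℕ → ℝ} (hw : ∀ k, 0 ≤ w k) (C : Set ℕ) (p ε : ℝ) (n : ℕ) :
    0 ≤ deviationMass w C p ε n :=
  Finset.sum_nonneg fun _ _ => OmegaP_nonneg hw _

theorem abs_mean_sub_le {w : ℕ → ℝ} (hw : ∀ k, 0 ≤ w k) (C : Set ℕ) {p ε : ℝ} (hp : 0 ≤ p)
    (hε : 0 < ε) {n : ℕ} (hn : 0 < n) (hZ : 0 < Zw w n) :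
    |(∑ P ∈ NCP n, OmegaP w P * (blockCount C P : ℝ)) / ((n : ℝ) * Zw w n) - p| ≤
      ε + (1 + p) * (deviationMass w C p ε n / Zw w n) := by
  have hn' : (0 : ℝ) < n := Nat.cast_pos.2 hn
  have e : (∑ P ∈ NCP n, OmegaP w P * (blockCount C P : ℝ)) / ((n : ℝ) * Zw w n) - p =
      (∑ P ∈ NCP n, OmegaP w P * ((blockCount C P : ℝ) / n - p)) / Zw w n := by
    simp only [mul_sub, Finset.sum_sub_distrib, ← Finset.sum_mul, ← mul_div_assoc,
      ← Finset.sum_div]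
    rw [← Zw]
    field_simp
  rw [e, abs_div, abs_of_pos hZ, ← mul_div_assoc, div_le_iff₀ hZ, add_mul, div_mul_cancel₀ _ hZ.ne',
    deviationMass, Zw, Finset.mul_sum, Finset.mul_sum, Finset.sum_filter, ← Finset.sum_add_distrib]
  refine (Finset.abs_sum_le_sum_abs _ _).trans (Finset.sum_le_sum fun P hP => ?_)
  have hΩ := OmegaP_nonneg hw P
  have h1 : (blockCount C P : ℝ) / n ≤ 1 := by
    rw [div_le_one hn']
    exact_mod_cast blockCount_le hP C
  have h0 : 0 ≤ (blockCount C P : ℝ) / n := by positivity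
  rw [abs_mul, abs_of_nonneg hΩ]
  split_ifs with h
  · have : |(blockCount C P : ℝ) / n - p| ≤ 1 + p := abs_le.2 ⟨by linarith, by linarith⟩
    nlinarith [mul_le_mul_of_nonneg_left this hΩ, mul_nonneg hε.le hΩ]
  · nlinarith [mul_le_mul_of_nonneg_left (not_lt.1 h) hΩ]

theorem tendsto_mean_of_tendsto_deviationMass {w : ℕ → ℝ} (hw : ∀ k, 0 ≤ w k) (C : Set ℕ) {p : ℝ}
    (hp : 0 ≤ p)
    (h : ∀ ε : ℝ, 0 < ε → Filter.Tendsto (fun n => deviationMass w C p ε n / Zw w n)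
      (Filter.atTop ⊓ Filter.principal {n : ℕ | 0 < Zw w n}) (nhds 0)) :
    Filter.Tendsto
      (fun n : ℕ => (∑ P ∈ NCP n, OmegaP w P * (blockCount C P : ℝ)) / ((n : ℝ) * Zw w n))
      (Filter.atTop ⊓ Filter.principal {n : ℕ | 0 < Zw w n}) (nhds p) := by
  rw [Metric.tendsto_nhds]
  intro ε hε
  have h1 : Filter.Tendsto (fun n => ε / 2 + (1 + p) * (deviationMass w C p (ε / 2) n / Zw w n))
      (Filter.atTop ⊓ Filter.principal {n : ℕ | 0 < Zw w n}) (nhds (ε / 2)) := by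
    simpa using ((h (ε / 2) (half_pos hε)).const_mul (1 + p)).const_add (ε / 2)
  filter_upwards [h1.eventually (gt_mem_nhds (half_lt_self hε)),
    Filter.mem_inf_of_left (Filter.eventually_gt_atTop 0),
    Filter.mem_inf_of_right (Filter.mem_principal_self _)] with n hn hn0 hZ
  rw [Real.dist_eq]
  exact (abs_mean_sub_le hw C hp (half_pos hε) hn0 hZ).trans_lt hn

theorem tendsto_deviationMass_of_le {w : ℕ → ℝ} (hw : ∀ k, 0 ≤ w k) (C : Set ℕ) {p ε K r : ℝ}
    (hr0 : 0 ≤ r) (hr : r < 1)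
    (h : ∀ n, 0 < n → 0 < Zw w n → deviationMass w C p ε n ≤ K * r ^ n * Zw w n) :
    Filter.Tendsto (fun n => deviationMass w C p ε n / Zw w n)
      (Filter.atTop ⊓ Filter.principal {n : ℕ | 0 < Zw w n}) (nhds 0) := by
  have ht : Filter.Tendsto (fun n : ℕ => K * r ^ n)
      (Filter.atTop ⊓ Filter.principal {n : ℕ | 0 < Zw w n}) (nhds 0) := by
    simpa using ((tendsto_pow_atTop_nhds_zero_of_lt_one hr0 hr).const_mul K).mono_left inf_le_left
  refine tendsto_of_tendsto_of_tendsto_of_le_of_le' tendsto_const_nhds ht ?_ ?_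
  · filter_upwards [Filter.mem_inf_of_right (Filter.mem_principal_self _)] with n hn
    exact div_nonneg (deviationMass_nonneg hw C p ε n) (le_of_lt hn)
  · filter_upwards [Filter.mem_inf_of_left (Filter.eventually_gt_atTop 0),
      Filter.mem_inf_of_right (Filter.mem_principal_self _)] with n hn0 hn
    exact (div_le_iff₀ hn).2 (h n hn0 hn)

theorem deviationMass_le {w : ℕ → ℝ} (hw : ∀ k, 0 ≤ w k) (C : Set ℕ) (p ε : ℝ) {t : ℝ}
    (ht : 0 < t) {n : ℕ} (hn : 0 < n) :
    deviationMass w C p ε n ≤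
      Real.exp (-(n * t * (p + ε))) * (∑ P ∈ NCP n, OmegaP w P * Real.exp t ^ blockCount C P) +
      Real.exp (n * t * (p - ε)) * (∑ P ∈ NCP n, OmegaP w P * Real.exp (-t) ^ blockCount C P) := by
  have hn' : (0 : ℝ) < n := Nat.cast_pos.2 hn
  rw [deviationMass, Finset.sum_filter, Finset.mul_sum, Finset.mul_sum, ← Finset.sum_add_distrib]
  refine Finset.sum_le_sum fun P _ => ?_
  have hΩ := OmegaP_nonneg hw P
  rw [← Real.exp_nat_mul, ← Real.exp_nat_mul, mul_left_comm, mul_left_comm (Real.exp _),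
    ← Real.exp_add, ← Real.exp_add, ← mul_add]
  set z : ℝ := (blockCount C P : ℝ)
  set A := Real.exp (-(n * t * (p + ε)) + z * t) with hA
  set B := Real.exp (n * t * (p - ε) + z * -t) with hB
  have hA0 : 0 < A := Real.exp_pos _
  have hB0 : 0 < B := Real.exp_pos _
  split_ifs with h
  · refine le_mul_of_one_le_right hΩ ?_
    rcases lt_abs.1 h with h | h
    · have h1 : n * (p + ε) < z := by
        rw [mul_comm, ← lt_div_iff₀ hn']
        linarith
      have : 1 ≤ A := Real.one_le_exp (by nlinarith [mul_pos ht (sub_pos.2 h1)])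
      linarith
    · have h1 : z < n * (p - ε) := by
        rw [mul_comm, ← div_lt_iff₀ hn']
        linarith
      have : 1 ≤ B := Real.one_le_exp (by nlinarith [mul_pos ht (sub_pos.2 h1)])
      linarith
  · positivity

theorem sum_OmegaP_mul_exp_le {w : ℕ → ℝ} (hw0 : w 0 = 1) (hw : ∀ k, 0 ≤ w k) {C : Set ℕ}
    (hC : 0 ∉ C) {ξ S p : ℝ} (hξ : 0 < ξ) (hS0 : 0 < S) (hp : 0 ≤ p)
    (hS : HasSum (fun k => w k * ξ ^ k) S)
    (hSp : HasSum (C.indicator fun k => w k * ξ ^ k) (S * p)) {t : ℝ} (ht : |t| ≤ 1) (n : ℕ) :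
    ∑ P ∈ NCP n, OmegaP w P * Real.exp t ^ blockCount C P ≤
      S * Real.exp (2 * p) * (S / ξ) ^ n * Real.exp (n * ((t + t ^ 2) * p)) := by
  set v : ℕ → ℝ := fun k => w k * if k ∈ C then Real.exp t else 1 with hv
  have hv0 : v 0 = 1 := by simp [hv, hw0, hC]
  have hvn : ∀ k, 0 ≤ v k := fun k => mul_nonneg (hw k) (by split_ifs <;> positivity)
  have hsum : HasSum (fun k => v k * ξ ^ k) (S + (Real.exp t - 1) * (S * p)) := by
    refine (hS.add (hSp.mul_left (Real.exp t - 1))).congr_fun ?_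
    intro k
    by_cases hk : k ∈ C
    · simp [hv, hk]
      ring
    · simp [hv, hk]
  have hle : S + (Real.exp t - 1) * (S * p) ≤ S * Real.exp ((t + t ^ 2) * p) := by
    have h1 := (abs_le.1 (Real.abs_exp_sub_one_sub_id_le ht)).2
    have h2 := Real.add_one_le_exp ((t + t ^ 2) * p)
    have h3 : (Real.exp t - 1) * p ≤ (t + t ^ 2) * p := mul_le_mul_of_nonneg_right (by linarith) hp
    nlinarith [mul_le_mul_of_nonneg_left (h2.trans' (add_le_add_left h3 1)) hS0.le]
  have hle2 : Real.exp ((t + t ^ 2) * p) ≤ Real.exp (2 * p) := by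
    have := abs_le.1 ht
    exact Real.exp_le_exp.2 (mul_le_mul_of_nonneg_right (by nlinarith) hp)
  have hnn : 0 ≤ S + (Real.exp t - 1) * (S * p) :=
    hsum.nonneg fun k => mul_nonneg (hvn k) (pow_nonneg hξ.le k)
  have h := Zw_le_of_summable hv0 hvn hξ hsum.summable n
  rw [hsum.tsum_eq] at h
  have e : Zw v n = ∑ P ∈ NCP n, OmegaP w P * Real.exp t ^ blockCount C P :=
    Finset.sum_congr rfl fun P _ => OmegaP_tilt w C (Real.exp t) P
  rw [← e]
  refine h.trans ?_
  calc _ ≤ (S * Real.exp (2 * p)) * ((S * Real.exp ((t + t ^ 2) * p)) / ξ) ^ n := by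
        gcongr
        exact hle.trans (by gcongr)
    _ = _ := by
        rw [Real.exp_nat_mul, mul_div_right_comm, mul_pow]
        ring

theorem tendsto_deviationMass_of_hasSum {w : ℕ → ℝ} (hw0 : w 0 = 1) (hw : ∀ k, 0 ≤ w k)
    {C : Set ℕ} (hC : 0 ∉ C) {ξ S p : ℝ} (hξ : 0 < ξ) (hS0 : 0 < S) (hp : 0 ≤ p)
    (hS : HasSum (fun k => w k * ξ ^ k) S)
    (hSp : HasSum (C.indicator fun k => w k * ξ ^ k) (S * p))
    (hmin : ∀ y, 0 < y → (Summable fun k => w k * y ^ k) → S / ξ * y ≤ ∑' k, w k * y ^ k)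
    {ε : ℝ} (hε : 0 < ε) :
    Filter.Tendsto (fun n => deviationMass w C p ε n / Zw w n)
      (Filter.atTop ⊓ Filter.principal {n : ℕ | 0 < Zw w n}) (nhds 0) := by
  set t := min 1 (ε / (2 * (p + 1))) with ht
  have ht0 : 0 < t := lt_min one_pos (by positivity)
  have ht1 : t ≤ 1 := min_le_left _ _
  have htp : t ^ 2 * p ≤ t * ε / 2 := by
    have h1 : t * (2 * (p + 1)) ≤ ε := (le_div_iff₀ (by positivity)).1 (min_le_right _ _)
    nlinarith [mul_le_mul_of_nonneg_left h1 ht0.le, sq_nonneg t]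
  set δ := t * ε / 4 with hδ
  have hδ0 : 0 < δ := by positivity
  set L := S / ξ * Real.exp (-δ) with hLdef
  have hL0 : 0 < L := by positivity
  have hL : L < S / ξ := mul_lt_of_lt_one_right (by positivity) (Real.exp_lt_one_iff.2 (by linarith))
  obtain ⟨c, hc0, hc⟩ := exists_forall_mul_pow_le_Zw hw0 hw hL0 hL hmin
  set K := S * Real.exp (2 * p) with hK
  have hK0 : 0 < K := by positivity
  refine tendsto_deviationMass_of_le hw C (K := 2 * K / c) (Real.exp_pos (-δ)).le
    (Real.exp_lt_one_iff.2 (by linarith)) fun n hn hZ => ?_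
  have hexp : ∀ a b : ℝ, a + b = n * (t ^ 2 * p - t * ε) →
      Real.exp a * (K * (S / ξ) ^ n * Real.exp b) ≤ K * (S / ξ) ^ n * Real.exp (-2 * δ) ^ n := by
    intro a b hab
    have : Real.exp a * Real.exp b ≤ Real.exp (-2 * δ) ^ n := by
      rw [← Real.exp_add, hab, ← Real.exp_nat_mul]
      exact Real.exp_le_exp.2 (mul_le_mul_of_nonneg_left (by rw [hδ]; linarith) (Nat.cast_nonneg n))
    calc _ = K * (S / ξ) ^ n * (Real.exp a * Real.exp b) := by ring
      _ ≤ _ := by gcongr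
  have hup := sum_OmegaP_mul_exp_le hw0 hw hC hξ hS0 hp hS hSp (t := t)
    (abs_le.2 ⟨by linarith, ht1⟩) n
  have hdown := sum_OmegaP_mul_exp_le hw0 hw hC hξ hS0 hp hS hSp (t := -t)
    (abs_le.2 ⟨by linarith, by linarith⟩) n
  calc deviationMass w C p ε n
      ≤ K * (S / ξ) ^ n * Real.exp (-2 * δ) ^ n + K * (S / ξ) ^ n * Real.exp (-2 * δ) ^ n := by
        refine (deviationMass_le hw C p ε ht0 hn).trans (add_le_add ?_ ?_)
        · exact (mul_le_mul_of_nonneg_left hup (Real.exp_pos _).le).trans (hexp _ _ (by ring))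
        · exact (mul_le_mul_of_nonneg_left hdown (Real.exp_pos _).le).trans (hexp _ _ (by ring))
    _ = 2 * K / c * Real.exp (-δ) ^ n * (c * L ^ n) := by
        have : Real.exp (-2 * δ) = Real.exp (-δ) * Real.exp (-δ) := by
          rw [← Real.exp_add]
          ring_nf
        rw [hLdef, this, mul_pow, mul_pow]
        field_simp
        ring
    _ ≤ _ := mul_le_mul_of_nonneg_left (hc n hZ) (by positivity)

theorem card_NCP_le (n : ℕ) : ((NCP n).card : ℝ) ≤ 2 * 4 ^ n := by
  have hg : HasSum (fun k : ℕ => (fun _ => (1 : ℝ)) k * (1 / 2 : ℝ) ^ k) 2 := by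
    simpa using hasSum_geometric_two
  have h := Zw_le_of_summable (v := fun _ => 1) rfl (fun _ => zero_le_one)
    (ξ := 1 / 2) (by norm_num) hg.summable n
  rw [hg.tsum_eq] at h
  norm_num [Zw, OmegaP] at h
  exact h

theorem OmegaP_mul_pow_le {w : ℕ → ℝ} (hw0 : w 0 = 1) (hw : ∀ k, 0 ≤ w k) {K : ℕ} {M B c : ℝ}
    (hM1 : 1 ≤ M) (hM : ∀ k ≤ K, w k ≤ M) (hB : 1 ≤ B) (hc0 : 0 < c)
    (hc : ∀ n, 0 < Zw w n → c * (M * B) ^ n ≤ Zw w n) {n : ℕ} {P : Finset (Finset ℕ)}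
    (hP : P ∈ NCP n) :
    c * OmegaP w P * B ^ (P.filter fun A => A.card ≤ K).card ≤ Zw w n := by
  have h := mem_NCP.1 hP
  set F := P.filter fun A => A.card ≤ K with hF
  set G := P.filter fun A => ¬ A.card ≤ K with hG
  set a := ∑ A ∈ F, A.card with ha
  have hab : a + ∑ A ∈ G, A.card = n := by
    rw [ha, hF, hG, Finset.sum_filter_add_sum_filter_not, h.sum_card]
    simp
  have hcard : F.card ≤ a := by
    rw [ha, Finset.card_eq_sum_ones]
    exact Finset.sum_le_sum fun A hA => (h.nonempty A (Finset.mem_filter.1 hA).1).card_pos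
  have hΩ : OmegaP w P = (∏ A ∈ F, w A.card) * ∏ A ∈ G, w A.card :=
    (Finset.prod_filter_mul_prod_filter_not P _ _).symm
  have hF0 : 0 ≤ ∏ A ∈ F, w A.card := Finset.prod_nonneg fun _ _ => hw _
  rcases hF0.eq_or_lt with h0 | h0
  · rw [hΩ, ← h0, zero_mul, mul_zero, zero_mul]
    exact Zw_nonneg hw n
  · have hFM : ∏ A ∈ F, w A.card ≤ M ^ a := by
      refine le_trans ?_ (pow_le_pow_right₀ hM1 hcard)
      rw [← Finset.prod_const]
      exact Finset.prod_le_prod (fun _ _ => hw _) fun A hA => hM _ (Finset.mem_filter.1 hA).2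
    have hZa := hc a (h0.trans_le (prod_le_Zw hw0 hw F))
    calc _ = c * (∏ A ∈ F, w A.card) * B ^ F.card * ∏ A ∈ G, w A.card := by rw [hΩ]; ring
      _ ≤ c * M ^ a * B ^ a * ∏ A ∈ G, w A.card := by
          gcongr
          exact Finset.prod_nonneg fun _ _ => hw _
      _ = c * (M * B) ^ a * ∏ A ∈ G, w A.card := by rw [mul_pow]; ring
      _ ≤ Zw w a * Zw w (∑ A ∈ G, A.card) := mul_le_mul hZa (prod_le_Zw hw0 hw G)
          (Finset.prod_nonneg fun _ _ => hw _) (Zw_nonneg hw a)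
      _ ≤ Zw w n := by
          conv_rhs => rw [← hab]
          exact Zw_mul_le hw0 hw _ _

theorem IsNC.mul_card_filter_le {S : Finset ℕ} {P : Finset (Finset ℕ)} (h : IsNC S P) (K : ℕ) :
    K * P.card ≤ S.card + K * (P.filter fun A => A.card ≤ K).card := by
  rw [← h.sum_card, ← Finset.card_filter_add_card_filter_not (s := P) fun A => A.card ≤ K, mul_add,
    add_comm]
  refine Nat.add_le_add_right ?_ _
  rw [mul_comm, ← smul_eq_mul, ← Finset.sum_const]
  exact (Finset.sum_le_sum fun A hA => (not_le.1 (Finset.mem_filter.1 hA).2).le).trans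
    (Finset.sum_le_sum_of_subset (Finset.filter_subset _ _))

theorem tendsto_deviationMass_of_not_summable {w : ℕ → ℝ} (hw0 : w 0 = 1) (hw : ∀ k, 0 ≤ w k)
    (C : Set ℕ) (hdiv : ∀ y, 0 < y → ¬ Summable fun k => w k * y ^ k) {ε : ℝ} (hε : 0 < ε) :
    Filter.Tendsto (fun n => deviationMass w C 0 ε n / Zw w n)
      (Filter.atTop ⊓ Filter.principal {n : ℕ | 0 < Zw w n}) (nhds 0) := by
  obtain ⟨K, hK⟩ := exists_nat_gt (2 / ε)
  have hK0 : (0 : ℝ) < K := lt_trans (by positivity) hK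
  have hKε : 2 ≤ K * ε := ((div_lt_iff₀ hε).1 hK).le
  set M := 1 + ∑ k ∈ Finset.range (K + 1), w k with hM
  have hM1 : 1 ≤ M := le_add_of_nonneg_right (Finset.sum_nonneg fun k _ => hw k)
  have hMw : ∀ k ≤ K, w k ≤ M := fun k hk =>
    (Finset.single_le_sum (fun k _ => hw k) (Finset.mem_range.2 (Nat.lt_succ_of_le hk))).trans
      (le_add_of_nonneg_left zero_le_one)
  set b := 2 * Real.log 8 / ε with hb
  have hb0 : 0 < b := by have := Real.log_pos (show (1 : ℝ) < 8 by norm_num); positivity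
  set B := Real.exp b with hB
  have hB1 : 1 ≤ B := Real.one_le_exp hb0.le
  obtain ⟨c, hc0, hc⟩ := exists_forall_mul_pow_le_Zw hw0 hw (L := M * B) (by positivity)
    (lt_add_one (M * B)) fun y hy hs => absurd hs (hdiv y hy)
  refine tendsto_deviationMass_of_le hw C (K := 2 / c) (r := 1 / 2) (by norm_num) (by norm_num)
    fun n hn hZ => ?_
  have hn' : (0 : ℝ) < n := Nat.cast_pos.2 hn
  have hbad : ∀ P ∈ (NCP n).filter fun P => ε < |(blockCount C P : ℝ) / (n : ℝ) - 0|,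
      OmegaP w P ≤ Zw w n / (c * 8 ^ n) := by
    intro P hP
    obtain ⟨hP, hdev⟩ := Finset.mem_filter.1 hP
    rw [sub_zero, abs_of_nonneg (by positivity), lt_div_iff₀ hn'] at hdev
    have hcount : (blockCount C P : ℝ) ≤ P.card := Nat.cast_le.2 (Finset.card_filter_le _ _)
    have hsmall : (K : ℝ) * P.card ≤ n + K * (P.filter fun A => A.card ≤ K).card := by
      have := (mem_NCP.1 hP).mul_card_filter_le K
      rw [Nat.card_Icc, Nat.add_sub_cancel] at this
      exact_mod_cast this
    set q := (P.filter fun A => A.card ≤ K).card with hq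
    have hqn : ε * n / 2 ≤ q := by
      refine le_of_mul_le_mul_left ?_ hK0
      nlinarith [mul_le_mul_of_nonneg_left (hdev.le.trans hcount) hK0.le,
        mul_le_mul_of_nonneg_right hKε hn'.le]
    have h8 : (8 : ℝ) ^ n ≤ B ^ q := by
      rw [hB, ← Real.exp_nat_mul]
      conv_lhs => rw [← Real.exp_log (show (0 : ℝ) < 8 by norm_num), ← Real.exp_nat_mul]
      refine Real.exp_le_exp.2 ?_
      calc (n : ℝ) * Real.log 8 = ε * n / 2 * b := by rw [hb]; field_simp
        _ ≤ q * b := mul_le_mul_of_nonneg_right hqn hb0.le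
    rw [le_div_iff₀ (by positivity)]
    calc OmegaP w P * (c * 8 ^ n) ≤ OmegaP w P * (c * B ^ q) := by
          have := OmegaP_nonneg hw P
          gcongr
      _ = c * OmegaP w P * B ^ q := by ring
      _ ≤ _ := OmegaP_mul_pow_le hw0 hw hM1 hMw hB1 hc0 hc hP
  calc deviationMass w C 0 ε n
      ≤ ((NCP n).filter fun P => ε < |(blockCount C P : ℝ) / (n : ℝ) - 0|).card •
          (Zw w n / (c * 8 ^ n)) := Finset.sum_le_card_nsmul _ _ _ hbad
    _ ≤ (2 * 4 ^ n) * (Zw w n / (c * 8 ^ n)) := by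
        rw [nsmul_eq_mul]
        refine mul_le_mul_of_nonneg_right ((Nat.cast_le.2 (Finset.card_filter_le _ _)).trans
          (card_NCP_le n)) (by positivity)
    _ = 2 / c * (1 / 2) ^ n * Zw w n := by
        rw [show (8 : ℝ) = 4 * 2 by norm_num, mul_pow, one_div, inv_pow]
        field_simp

theorem div_mul_le_tsum {w : ℕ → ℝ} (hw : ∀ k, 0 ≤ w k) {ξ : ℝ} (hξ : 0 < ξ)
    (hsξ : Summable fun k => w k * ξ ^ k) (hs' : Summable fun k : ℕ => (k : ℝ) * w k * ξ ^ k)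
    (hopt : ∑' k : ℕ, (k : ℝ) * w k * ξ ^ k = ∑' k : ℕ, w k * ξ ^ k ∨
      (ENNReal.ofReal ξ = (wLimsup w)⁻¹ ∧
        ∑' k : ℕ, (k : ℝ) * w k * ξ ^ k ≤ ∑' k : ℕ, w k * ξ ^ k))
    {y : ℝ} (hy : 0 < y) (hsy : Summable fun k => w k * y ^ k) :
    (∑' k, w k * ξ ^ k) / ξ * y ≤ ∑' k, w k * y ^ k := by
  refine le_trans ?_ (tsum_add_mul_sub_le hw hξ hy hsξ hs' hsy)
  rw [div_mul_eq_mul_div, mul_div_assoc]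
  rcases hopt with h | ⟨hρ, h⟩
  · rw [h]
    linarith
  · have hyξ : y ≤ ξ := by
      have h1 := ENNReal.inv_le_inv.2 (wLimsup_le_of_summable hw hy hsy)
      rw [← hρ, one_div, ENNReal.ofReal_inv_of_pos hy, inv_inv] at h1
      exact (ENNReal.ofReal_le_ofReal_iff hξ.le).1 h1
    have h2 : y / ξ ≤ 1 := (div_le_one hξ).2 hyξ
    nlinarith [mul_nonneg (sub_nonneg.2 h) (sub_nonneg.2 h2)]

theorem PiSpec.tendsto_deviationMass {w π : ℕ → ℝ} (hπ : PiSpec w π) (hw0 : w 0 = 1)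
    (hw : ∀ k, 0 ≤ w k) {C : Set ℕ} (hC : 0 ∉ C) {ε : ℝ} (hε : 0 < ε) :
    Filter.Tendsto (fun n => deviationMass w C (∑' c : C, π (c : ℕ)) ε n / Zw w n)
      (Filter.atTop ⊓ Filter.principal {n : ℕ | 0 < Zw w n}) (nhds 0) := by
  rcases hπ with ⟨htop, -, hπ⟩ | ⟨-, ξ, hξ, -, hs', hπ, hopt⟩
  · have h0 : ∑' c : C, π (c : ℕ) = 0 := by
      have : ∀ c : C, π (c : ℕ) = 0 := fun c =>
        hπ c (Nat.one_le_iff_ne_zero.2 fun h => hC (h ▸ c.2))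
      simp [this]
    rw [h0]
    refine tendsto_deviationMass_of_not_summable hw0 hw C (fun y hy hs => ?_) hε
    have := wLimsup_le_of_summable hw hy hs
    rw [htop, top_le_iff] at this
    exact ENNReal.ofReal_ne_top this
  · have hs : Summable fun k => w k * ξ ^ k := by
      rw [← summable_nat_add_iff 1] at hs' ⊢
      refine Summable.of_nonneg_of_le (fun k => mul_nonneg (hw _) (by positivity)) (fun k => ?_) hs'
      rw [mul_assoc]
      refine le_mul_of_one_le_left (mul_nonneg (hw _) (by positivity)) ?_
      push_cast
      linarith [(Nat.cast_nonneg k : (0 : ℝ) ≤ k)]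
    have hnn : ∀ k, 0 ≤ w k * ξ ^ k := fun k => mul_nonneg (hw k) (by positivity)
    have hS0 : 0 < ∑' k, w k * ξ ^ k := by
      refine lt_of_lt_of_le one_pos ?_
      simpa [hw0] using hs.le_tsum 0 fun k _ => hnn k
    have hp : ∑' c : C, π (c : ℕ) =
        (∑' k, C.indicator (fun k => w k * ξ ^ k) k) / ∑' k, w k * ξ ^ k := by
      simp only [hπ]
      rw [tsum_div_const, tsum_subtype C fun k => w k * ξ ^ k]
    refine tendsto_deviationMass_of_hasSum hw0 hw hC hξ hS0 ?_ hs.hasSum ?_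
      (fun y hy hsy => div_mul_le_tsum hw hξ hs hs' hopt hy hsy) hε
    · exact tsum_nonneg fun c => hπ c ▸ div_nonneg (hnn c) hS0.le
    · rw [hp, mul_div_cancel₀ _ hS0.ne']
      exact (hs.indicator C).hasSum

theorem PiSpec.nonneg {w π : ℕ → ℝ} (hπ : PiSpec w π) (hw : ∀ k, 0 ≤ w k) (k : ℕ) : 0 ≤ π k := by
  rcases hπ with ⟨-, h0, hπ⟩ | ⟨-, ξ, hξ, -, -, hπ, -⟩
  · rcases Nat.eq_zero_or_pos k with rfl | hk
    · rw [h0]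
      exact zero_le_one
    · exact (hπ k hk).ge
  · rw [hπ]
    exact div_nonneg (mul_nonneg (hw k) (by positivity))
      (tsum_nonneg fun j => mul_nonneg (hw j) (by positivity))

/-- under `ℙ^w_n`, the number `ζ_C` of blocks with size in `C`
satisfies `ζ_C/n → π(C)` in probability and in expectation. -/
theorem stmt15 (w : ℕ → ℝ) (hw0 : w 0 = 1) (hw : ∀ i : ℕ, 0 ≤ w i)
    (hw2 : ∃ k : ℕ, 2 ≤ k ∧ 0 < w k)
    (π : ℕ → ℝ) (hπ : PiSpec w π)
    (C : Set ℕ) (hC : C.Nonempty) (hCpos : ∀ c ∈ C, 1 ≤ c) :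
    (∀ ε : ℝ, 0 < ε →
      Filter.Tendsto
        (fun n : ℕ =>
          (∑ P ∈ (NCP n).filter fun P =>
              ε < |((P.filter fun B => B.card ∈ C).card : ℝ) / (n : ℝ) -
                    ∑' c : C, π (c : ℕ)|, OmegaP w P) / Zw w n)
        (Filter.atTop ⊓ Filter.principal {n : ℕ | 0 < Zw w n})
        (nhds 0)) ∧
    Filter.Tendsto
      (fun n : ℕ =>
        (∑ P ∈ NCP n, OmegaP w P * ((P.filter fun B => B.card ∈ C).card : ℝ)) /
          ((n : ℝ) * Zw w n))
      (Filter.atTop ⊓ Filter.principal {n : ℕ | 0 < Zw w n})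
      (nhds (∑' c : C, π (c : ℕ))) := by
  have h0 : 0 ∉ C := fun h => absurd (hCpos 0 h) (by norm_num)
  have h := fun ε (hε : (0 : ℝ) < ε) => hπ.tendsto_deviationMass hw0 hw h0 hε
  exact ⟨h, tendsto_mean_of_tendsto_deviationMass hw C
    (tsum_nonneg fun c => hπ.nonneg hw c) h⟩
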